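/- (Stability of the full-discrete θ-scheme.) Fix an integer N ≥ 2, a real number α with 1 < α < 2, constants κ_α > 0, ν_α > 0, p, q ≥ 0 with p + q = 1, and θ with 1/2 ≤ θ ≤ 1. Let P_N be the Legendre polynomial of degree N, let -1 = x_0 < … < x_N = 1 be the roots of (1-x²)P_N'(x), let w_i = 2/(N(N+1)P_N(x_i)²), and ‖u‖_N² = Σ_{i=0}^N u(x_i)² w_i. Then there exist constants C > 0 and τ_0 > 0, depending only on N, α, κ_α, p, q, θ, with the following property: for every time step τ ∈ (0, τ_0], every sequence (U^k)_{k≥0} of polynomials of degree at most N with U^k(±1) = 0, and every sequence (f^k)_{k≥0} of nodal data satisfying, for all k ≥ 0 and all interior nodes x_j (1 ≤ j ≤ N-1), (U^{k+1}(x_j) − U^k(x_j))/τ = κ_α ∇^α U_θ^{k+1}(x_j) − ν_α (U_θ^{k+1})'(x_j) + f_θ^{k+1}(x_j), where U_θ^{k+1} = θU^{k+1} + (1-θ)U^k and f_θ^{k+1}(x_j) = θ f^{k+1}(x_j) + (1-θ) f^k(x_j), one has for every M ≥ 1, with T = Mτ: ‖U^M‖_N² ≤ exp(CT)·(‖U^0‖_N²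 + τ Σ_{k=0}^M ‖f^k‖_N²). -/

import Mathlib

open Finset Polynomial

/-- The Legendre polynomial of degree `N`, via the Rodrigues formula
`P_N(x) = (1/(2^N N!)) (d/dx)^N (x²-1)^N`. -/
noncomputable def legendreP (N : ℕ) (x : ℝ) : ℝ :=
  (1 / ((2 : ℝ) ^ N * N.factorial)) * iteratedDeriv N (fun y => (y ^ 2 - 1) ^ N) x

/-- The two-sided Riemann–Liouville fractional operator
`∇^α u = p ‧ _{-1}D_x^α u + q ‧ _xD_1^α u` of order `1 < α < 2` on `[-1,1]`. -/
noncomputable def fracGrad (α p q : ℝ) (u : ℝ → ℝ) (y : ℝ) : ℝ :=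
  p * ((1 / Real.Gamma (2 - α)) *
      iteratedDeriv 2 (fun z => ∫ ξ in (-1 : ℝ)..z, u ξ * (z - ξ) ^ (1 - α)) y) +
  q * ((1 / Real.Gamma (2 - α)) *
      iteratedDeriv 2 (fun z => ∫ ξ in z..(1 : ℝ), u ξ * (ξ - z) ^ (1 - α)) y)

section NodalDerivative

variable {ι : Type*} [Fintype ι] {x : ι → ℝ} {W : ℝ[X]}

/-- A nonzero polynomial of degree at most the number of its given distinct roots has only
simple roots among them. -/
lemma eval_derivative_ne_zero_of_roots (hx : Function.Injective x) (hW : W ≠ 0)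
    (hdeg : W.natDegree ≤ Fintype.card ι) (hroot : ∀ i, W.eval (x i) = 0) (i : ι) :
    W.derivative.eval (x i) ≠ 0 := by
  intro h
  obtain ⟨Q, hQ⟩ := dvd_iff_isRoot.2 (hroot i)
  have hQ0 : Q ≠ 0 := by rintro rfl; simp [hQ] at hW
  have hQdeg : W.natDegree = 1 + Q.natDegree := by
    rw [hQ, natDegree_mul (X_sub_C_ne_zero _) hQ0, natDegree_X_sub_C]
  refine hQ0 (eq_zero_of_degree_lt_of_eval_index_eq_zero
    Finset.univ (v := x) hx.injOn ?_ ?_)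
  · rw [degree_eq_natDegree hQ0, card_univ]
    exact_mod_cast by omega
  · intro j _
    rcases eq_or_ne j i with rfl | hj
    · simpa [hQ] using h
    · have := hroot j
      rw [hQ] at this
      simpa [sub_eq_zero, hx.ne hj] using this

/-- Differentiation is skew-symmetric for the discrete inner product with weights
`1 / W'(x_i)²`, on polynomials vanishing at every node where `W''` does not vanish. -/
lemma sum_eval_mul_eval_derivative_div_eq_zero (hx : Function.Injective x) (hW : W ≠ 0)
    (hdeg : W.natDegree ≤ Fintype.card ι) (hroot : ∀ i, W.eval (x i) = 0) {u : ℝ[X]}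
    (hu : u.degree < Fintype.card ι)
    (hu0 : ∀ i, W.derivative.derivative.eval (x i) = 0 ∨ u.eval (x i) = 0) :
    ∑ j, u.eval (x j) * u.derivative.eval (x j) / W.derivative.eval (x j) ^ 2 = 0 := by
  have hW' := eval_derivative_ne_zero_of_roots hx hW hdeg hroot
  choose Q hQ using fun i => dvd_iff_isRoot.2 (hroot i)
  have hQ0 : ∀ i, Q i ≠ 0 := fun i h => by
    have := hQ i
    simp [h, hW] at this
  have hQdeg : ∀ i, (Q i).degree < Fintype.card ι := fun i => by
    have : W.natDegree = 1 + (Q i).natDegree := by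
      conv_lhs => rw [hQ i, natDegree_mul (X_sub_C_ne_zero _) (hQ0 i), natDegree_X_sub_C]
    rw [degree_eq_natDegree (hQ0 i)]
    exact_mod_cast by omega
  have hd : ∀ i, W.derivative = Q i + (X - C (x i)) * (Q i).derivative := fun i => by
    conv_lhs => rw [hQ i]
    simp
  have hdd : ∀ i, W.derivative.derivative =
      2 * (Q i).derivative + (X - C (x i)) * (Q i).derivative.derivative := fun i => by
    conv_lhs => rw [hd i]
    simp
    ring
  have hself : ∀ i, (Q i).eval (x i) = W.derivative.eval (x i) := fun i => by simp [hd i]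
  have hne : ∀ i j, j ≠ i → (Q i).eval (x j) = 0 := fun i j hj => by
    have := hroot j
    rw [hQ i] at this
    simpa [sub_eq_zero, hx.ne hj] using this
  have hdself : ∀ i, (Q i).derivative.eval (x i) = W.derivative.derivative.eval (x i) / 2 :=
    fun i => by simp [hdd i]
  have hdne : ∀ i j, j ≠ i →
      (Q i).derivative.eval (x j) = W.derivative.eval (x j) / (x j - x i) := fun i j hj => by
    rw [eq_div_iff (sub_ne_zero.2 (hx.ne hj)), hd i]
    simp [hne i j hj, mul_comm]
  set a : ι → ℝ := fun i => u.eval (x i) / W.derivative.eval (x i) with ha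
  have hrepr : u = ∑ i, C (a i) * Q i := by
    refine eq_of_degrees_lt_of_eval_index_eq Finset.univ (v := x) hx.injOn
      (by simpa using hu) ?_ ?_
    · refine lt_of_le_of_lt (degree_sum_le _ _) ((Finset.sup_lt_iff ?_).2 fun i _ => ?_)
      · exact WithBot.bot_lt_coe _
      · rw [← smul_eq_C_mul]
        exact lt_of_le_of_lt (degree_smul_le _ _) (by simpa using hQdeg i)
    · intro j _
      rw [eval_finsetSum, Finset.sum_eq_single j]
      · simp [ha, hself, div_mul_cancel₀ _ (hW' j)]
      · intro i _ hij
        simp [hne i j hij.symm]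
      · simp
  have hterm : ∀ j, u.eval (x j) * u.derivative.eval (x j) / W.derivative.eval (x j) ^ 2 =
      ∑ i, a i * a j / (x j - x i) := fun j => by
    have h1 : u.derivative.eval (x j) = ∑ i, a i * (Q i).derivative.eval (x j) := by
      conv_lhs => rw [hrepr]
      simp [eval_finsetSum]
    rw [h1, Finset.mul_sum, Finset.sum_div]
    refine Finset.sum_congr rfl fun i _ => ?_
    have := hW' j
    rcases eq_or_ne j i with rfl | hij
    · rw [hdself]
      rcases hu0 j with h | h <;> simp [h]
    · rw [hdne i j hij]
      have := sub_ne_zero.2 (hx.ne hij)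
      simp only [ha]
      field_simp
  simp only [hterm]
  have hanti : ∑ j, ∑ i, a i * a j / (x j - x i) = -∑ j, ∑ i, a i * a j / (x j - x i) := by
    conv_lhs => rw [Finset.sum_comm]
    rw [← Finset.sum_neg_distrib]
    refine Finset.sum_congr rfl fun i _ => ?_
    rw [← Finset.sum_neg_distrib]
    refine Finset.sum_congr rfl fun j _ => ?_
    rw [← neg_sub (x i) (x j), div_neg, mul_comm]
  linarith

end NodalDerivative

section Legendre

/-- The Legendre polynomial of degree `N` as a formal polynomial. -/
noncomputable def legendrePoly (N : ℕ) : ℝ[X] :=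
  C (1 / ((2 : ℝ) ^ N * N.factorial)) * derivative^[N] ((X ^ 2 - 1) ^ N)

lemma iteratedDeriv_polynomial_eval (n : ℕ) (u : ℝ[X]) :
    iteratedDeriv n (fun y => u.eval y) = fun y => (derivative^[n] u).eval y := by
  induction n with
  | zero => simp
  | succ n ih =>
    rw [iteratedDeriv_succ, ih, Function.iterate_succ_apply']
    ext y
    exact Polynomial.deriv _

lemma legendreP_eq_eval (N : ℕ) : legendreP N = fun x => (legendrePoly N).eval x := by
  ext x
  have : (fun y : ℝ => (y ^ 2 - 1) ^ N) = fun y => ((X ^ 2 - 1 : ℝ[X]) ^ N).eval y := by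
    ext; simp
  simp [legendreP, legendrePoly, this, iteratedDeriv_polynomial_eval]

lemma iterate_derivative_X_sq_sub_one_pow (N k : ℕ) :
    (X ^ 2 - 1 : ℝ[X]) * derivative^[k + 2] ((X ^ 2 - 1) ^ N)
      + 2 * ((k : ℝ[X]) + 1) * X * derivative^[k + 1] ((X ^ 2 - 1) ^ N)
      + ((k : ℝ[X]) + 1) * (k : ℝ[X]) * derivative^[k] ((X ^ 2 - 1) ^ N) =
    2 * (N : ℝ[X]) * (X * derivative^[k + 1] ((X ^ 2 - 1) ^ N)
      + ((k : ℝ[X]) + 1) * derivative^[k] ((X ^ 2 - 1) ^ N)) := by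
  induction k with
  | zero =>
    have h : (X ^ 2 - 1 : ℝ[X]) * derivative ((X ^ 2 - 1 : ℝ[X]) ^ N) =
        2 * (N : ℝ[X]) * X * (X ^ 2 - 1) ^ N := by
      rcases N with _ | n
      · simp
      · simp only [derivative_pow, derivative_sub, derivative_X, derivative_one, map_natCast,
          add_tsub_cancel_right]
        ring
    have h' := congrArg derivative h
    simp only [derivative_mul, derivative_sub, derivative_X_sq, derivative_one, derivative_X,
      derivative_natCast, derivative_ofNat] at h'
    simp only [Function.iterate_succ_apply', Function.iterate_zero, id]
    simp only [map_ofNat, Nat.cast_zero] at h' ⊢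
    linear_combination h'
  | succ k ih =>
    have h' := congrArg derivative ih
    simp only [derivative_mul, derivative_sub, derivative_add, derivative_X_sq, derivative_one,
      derivative_X, derivative_natCast, derivative_ofNat, ← Function.iterate_succ_apply' derivative]
      at h'
    simp only [map_ofNat] at h'
    push_cast
    linear_combination h'

/-- The Legendre differential equation `d/dx ((1 - x²) dP_N/dx) = -N (N + 1) P_N`. -/
lemma derivative_one_sub_sq_mul_derivative_legendrePoly (N : ℕ) :
    derivative ((1 - X ^ 2) * derivative (legendrePoly N)) =
      -C ((N : ℝ) * (N + 1)) * legendrePoly N := by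
  have h := iterate_derivative_X_sq_sub_one_pow N N
  simp only [legendrePoly, ← Function.iterate_succ_apply' derivative,
    derivative_mul, derivative_sub, derivative_one, derivative_X_sq, derivative_C, derivative_zero,
    map_mul, map_add, map_natCast, map_one, map_ofNat]
  simp only [Nat.succ_eq_add_one]
  linear_combination (-C (1 / ((2 : ℝ) ^ N * N.factorial))) * h

lemma natDegree_X_sq_sub_one_pow (N : ℕ) : ((X ^ 2 - 1 : ℝ[X]) ^ N).natDegree = 2 * N := by
  rw [natDegree_pow, show (1 : ℝ[X]) = C 1 by simp, natDegree_X_pow_sub_C, mul_comm]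

lemma natDegree_legendrePoly_le (N : ℕ) : (legendrePoly N).natDegree ≤ N := by
  refine (natDegree_C_mul_le _ _).trans ((natDegree_iterate_derivative _ _).trans ?_)
  rw [natDegree_X_sq_sub_one_pow]
  omega

lemma derivative_legendrePoly_ne_zero {N : ℕ} (hN : 1 ≤ N) :
    derivative (legendrePoly N) ≠ 0 := by
  intro h
  rw [legendrePoly, derivative_C_mul, ← Function.iterate_succ_apply' derivative] at h
  have hc := congrArg (fun v : ℝ[X] => v.coeff (N - 1)) h
  have hm : ((X ^ 2 - 1 : ℝ[X]) ^ N).Monic := by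
    refine Monic.pow ?_ N
    rw [show (1 : ℝ[X]) = C 1 by simp]
    exact monic_X_pow_sub_C 1 two_ne_zero
  have hlead : ((X ^ 2 - 1 : ℝ[X]) ^ N).coeff (N - 1 + (N + 1)) = 1 := by
    have := hm.coeff_natDegree
    rwa [natDegree_X_sq_sub_one_pow, show 2 * N = N - 1 + (N + 1) by omega] at this
  simp only [coeff_C_mul, coeff_iterate_derivative, Nat.succ_eq_add_one, hlead, coeff_zero,
    nsmul_eq_mul, mul_one] at hc
  have : (N - 1 + (N + 1)).descFactorial (N + 1) ≠ 0 := by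
    rw [Ne, Nat.descFactorial_eq_zero_iff_lt]
    omega
  have h2 : ((N.factorial : ℕ) : ℝ) ≠ 0 := Nat.cast_ne_zero.2 (Nat.factorial_ne_zero N)
  simp_all

end Legendre

section FractionalGradient

open MeasureTheory intervalIntegral

/-- Up to the factor `1 / Γ(2 - α)`, the left Riemann–Liouville integral of order `2 - α`. -/
noncomputable def leftFracIntegral (α : ℝ) (u : ℝ → ℝ) (z : ℝ) : ℝ :=
  ∫ ξ in (-1 : ℝ)..z, u ξ * (z - ξ) ^ (1 - α)

/-- Up to the factor `1 / Γ(2 - α)`, the right Riemann–Liouville integral of order `2 - α`. -/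
noncomputable def rightFracIntegral (α : ℝ) (u : ℝ → ℝ) (z : ℝ) : ℝ :=
  ∫ ξ in z..(1 : ℝ), u ξ * (ξ - z) ^ (1 - α)

variable {α : ℝ}

lemma intervalIntegrable_mul_sub_rpow (hα : α < 2) {u : ℝ → ℝ} (hu : Continuous u) (z : ℝ) :
    IntervalIntegrable (fun ξ => u ξ * (z - ξ) ^ (1 - α)) volume (-1) z := by
  refine IntervalIntegrable.continuousOn_mul ?_ hu.continuousOn
  have h := (intervalIntegrable_rpow' (a := z + 1) (b := 0)
    (show (-1 : ℝ) < 1 - α by linarith)).comp_sub_left z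
  simpa using h

lemma leftFracIntegral_add (hα : α < 2) {u v : ℝ → ℝ} (hu : Continuous u) (hv : Continuous v) :
    leftFracIntegral α (u + v) = leftFracIntegral α u + leftFracIntegral α v := by
  ext z
  simp only [leftFracIntegral, Pi.add_apply, add_mul]
  exact integral_add (intervalIntegrable_mul_sub_rpow hα hu z)
    (intervalIntegrable_mul_sub_rpow hα hv z)

lemma leftFracIntegral_smul (c : ℝ) (u : ℝ → ℝ) :
    leftFracIntegral α (c • u) = c • leftFracIntegral α u := by
  ext z
  simp [leftFracIntegral, mul_assoc]

lemma rightFracIntegral_eq (u : ℝ → ℝ) :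
    rightFracIntegral α u = leftFracIntegral α (fun ξ => u (-ξ)) ∘ Neg.neg := by
  ext z
  have := integral_comp_neg (a := (-1 : ℝ)) (b := -z) (fun ξ => u ξ * (ξ - z) ^ (1 - α))
  rw [neg_neg, neg_neg] at this
  simp only [rightFracIntegral, leftFracIntegral, Function.comp, ← this]
  refine integral_congr fun ξ _ => ?_
  ring_nf

lemma leftFracIntegral_add_one_pow (k : ℕ) {z : ℝ} (hz : -1 < z) :
    leftFracIntegral α (fun ξ => (ξ + 1) ^ k) z =
      (z + 1) ^ (k + 1) * (z + 1) ^ (1 - α) * ∫ t in (0 : ℝ)..1, t ^ k * (1 - t) ^ (1 - α) := by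
  have h := mul_integral_comp_mul_sub (a := 0) (b := 1) (f :=
    fun ξ : ℝ => (ξ + 1) ^ k * (z - ξ) ^ (1 - α)) (c := z + 1) (d := 1)
  have hz' : 0 < z + 1 := by linarith
  simp only [mul_zero, zero_sub, mul_one, add_sub_cancel_right] at h
  rw [leftFracIntegral, ← h, pow_succ', mul_assoc (z + 1), mul_assoc (z + 1)]
  refine congrArg _ ?_
  rw [← intervalIntegral.integral_const_mul]
  refine intervalIntegral.integral_congr fun t ht => ?_
  rw [Set.uIcc_of_le zero_le_one] at ht
  have h1 : z - ((z + 1) * t - 1) = (z + 1) * (1 - t) := by ring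
  simp only [sub_add_cancel, h1, mul_pow]
  rw [Real.mul_rpow hz'.le (by linarith [ht.2])]
  ring

lemma contDiffAt_leftFracIntegral (hα : α < 2) (u : ℝ[X]) {y : ℝ} (hy : -1 < y) {n : WithTop ℕ∞} :
    ContDiffAt ℝ n (leftFracIntegral α fun ξ => u.eval ξ) y := by
  suffices h : ∀ v : ℝ[X], ContDiffAt ℝ n (leftFracIntegral α fun ξ => v.eval (ξ + 1)) y by
    have hu : ∀ ξ, (u.comp (X - C 1)).eval (ξ + 1) = u.eval ξ := fun ξ => by
      rw [eval_comp, eval_sub, eval_X, eval_C, add_sub_cancel_right]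
    exact (funext hu : (fun ξ => (u.comp (X - C 1)).eval (ξ + 1)) = fun ξ => u.eval ξ) ▸
      h (u.comp (X - C 1))
  intro v
  induction v using Polynomial.induction_on' with
  | add v₁ v₂ h₁ h₂ =>
    have := leftFracIntegral_add hα (u := fun ξ => v₁.eval (ξ + 1))
      (v := fun ξ => v₂.eval (ξ + 1)) (by fun_prop) (by fun_prop)
    simp only [eval_add]
    exact this ▸ h₁.add h₂
  | monomial k c =>
    have := leftFracIntegral_smul (α := α) c (fun ξ => (ξ + 1) ^ k)
    simp only [eval_monomial]
    refine this ▸ ContDiffAt.const_smul c ?_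
    have hev : leftFracIntegral α (fun ξ => (ξ + 1) ^ k) =ᶠ[nhds y] fun z =>
        (z + 1) ^ (k + 1) * (z + 1) ^ (1 - α) *
          ∫ t in (0 : ℝ)..1, t ^ k * (1 - t) ^ (1 - α) := by
      filter_upwards [lt_mem_nhds hy] with z hz using leftFracIntegral_add_one_pow k hz
    refine ContDiffAt.congr_of_eventuallyEq ?_ hev
    have hne : y + 1 ≠ 0 := by linarith
    have h1 : ContDiffAt ℝ n (fun z : ℝ => z + 1) y := by fun_prop
    exact ((h1.pow _).mul (h1.rpow_const_of_ne hne)).mul contDiffAt_const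

lemma contDiffAt_rightFracIntegral (hα : α < 2) (u : ℝ[X]) {y : ℝ} (hy : y < 1)
    {n : WithTop ℕ∞} : ContDiffAt ℝ n (rightFracIntegral α fun ξ => u.eval ξ) y := by
  rw [rightFracIntegral_eq]
  refine ContDiffAt.comp y ?_ contDiffAt_id.neg
  simpa using contDiffAt_leftFracIntegral hα (u.comp (-X)) (y := -y) (by linarith)

lemma fracGrad_eq (α p q : ℝ) (u : ℝ → ℝ) (y : ℝ) : fracGrad α p q u y =
    p * ((1 / Real.Gamma (2 - α)) * iteratedDeriv 2 (leftFracIntegral α u) y) +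
    q * ((1 / Real.Gamma (2 - α)) * iteratedDeriv 2 (rightFracIntegral α u) y) := rfl

/-- The fractional operator at an interior point, as a linear functional on polynomials. -/
noncomputable def fracGradLinear (hα : α < 2) (p q : ℝ) {y : ℝ} (hy : y ∈ Set.Ioo (-1 : ℝ) 1) :
    ℝ[X] →ₗ[ℝ] ℝ where
  toFun u := fracGrad α p q (fun s => u.eval s) y
  map_add' u v := by
    have hl := leftFracIntegral_add hα (u := fun s => u.eval s) (v := fun s => v.eval s)
      u.continuous v.continuous
    have hr : rightFracIntegral α ((fun s => u.eval s) + fun s => v.eval s) =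
        (rightFracIntegral α fun s => u.eval s) + rightFracIntegral α fun s => v.eval s := by
      simp only [rightFracIntegral_eq]
      exact congrArg (· ∘ Neg.neg) (leftFracIntegral_add hα
        (u.continuous.comp continuous_neg) (v.continuous.comp continuous_neg))
    have huv : (fun s => (u + v).eval s) = (fun s => u.eval s) + fun s => v.eval s := by
      ext; simp
    rw [huv, fracGrad_eq, hl, hr,
      iteratedDeriv_add (contDiffAt_leftFracIntegral hα u hy.1)
        (contDiffAt_leftFracIntegral hα v hy.1),
      iteratedDeriv_add (contDiffAt_rightFracIntegral hα u hy.2)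
        (contDiffAt_rightFracIntegral hα v hy.2), fracGrad_eq, fracGrad_eq]
    ring
  map_smul' c u := by
    have hl := leftFracIntegral_smul (α := α) c (fun s => u.eval s)
    have hr : rightFracIntegral α (c • fun s => u.eval s) =
        c • rightFracIntegral α fun s => u.eval s := by
      simp only [rightFracIntegral_eq]
      exact congrArg (· ∘ Neg.neg) (leftFracIntegral_smul c (fun s => u.eval (-s)))
    have hcu : (fun s => (c • u).eval s) = c • fun s => u.eval s := by
      ext; simp
    rw [hcu, fracGrad_eq, hl, hr,
      iteratedDeriv_const_smul (contDiffAt_leftFracIntegral hα u hy.1),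
      iteratedDeriv_const_smul (contDiffAt_rightFracIntegral hα u hy.2), fracGrad_eq]
    simp only [smul_eq_mul, RingHom.id_apply]
    ring

end FractionalGradient

section Stability

/-- A family of linear functionals on polynomials gives a form bounded by the discrete norm on
polynomials determined by their nodal values. -/
lemma exists_abs_sum_mul_le {ι : Type*} [Fintype ι] {x : ι → ℝ} (hx : Function.Injective x)
    {w : ι → ℝ} (hw : ∀ i, 0 < w i) (L : ι → ℝ[X] →ₗ[ℝ] ℝ) :
    ∃ K, 0 ≤ K ∧ ∀ u : ℝ[X], u.degree < Fintype.card ι →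
      |∑ j, w j * (u.eval (x j) * L j u)| ≤ K * ∑ j, u.eval (x j) ^ 2 * w j := by
  classical
  set ℓ := Lagrange.basis Finset.univ x with hℓ
  set D := ∑ i, 1 / w i with hD
  refine ⟨∑ j, ∑ i, w j * |L j (ℓ i)| * D, ?_, fun u hu => ?_⟩
  · have hD0 : 0 ≤ D := Finset.sum_nonneg fun i _ => (one_div_pos.2 (hw i)).le
    exact Finset.sum_nonneg fun j _ => Finset.sum_nonneg fun i _ =>
      mul_nonneg (mul_nonneg (hw j).le (abs_nonneg _)) hD0
  set S := ∑ j, u.eval (x j) ^ 2 * w j with hS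
  have hrepr : u = ∑ i, u.eval (x i) • ℓ i := by
    conv_lhs => rw [Lagrange.eq_interpolate (s := Finset.univ) (f := u) hx.injOn
      (by simpa using hu)]
    simp [Lagrange.interpolate_apply, smul_eq_C_mul, hℓ]
  have hS0 : 0 ≤ S := Finset.sum_nonneg fun i _ => mul_nonneg (sq_nonneg _) (hw i).le
  have hsq : ∀ i, u.eval (x i) ^ 2 ≤ D * S := fun i => by
    have h1 : u.eval (x i) ^ 2 * w i ≤ S :=
      Finset.single_le_sum (f := fun j => u.eval (x j) ^ 2 * w j)
        (fun j _ => mul_nonneg (sq_nonneg _) (hw j).le) (Finset.mem_univ i)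
    have h2 : 1 / w i ≤ D :=
      Finset.single_le_sum (f := fun j => 1 / w j)
        (fun j _ => (one_div_pos.2 (hw j)).le) (Finset.mem_univ i)
    calc u.eval (x i) ^ 2 = 1 / w i * (u.eval (x i) ^ 2 * w i) := by
          have := (hw i).ne'
          field_simp
      _ ≤ D * S := mul_le_mul h2 h1 (mul_nonneg (sq_nonneg _) (hw i).le)
          ((one_div_pos.2 (hw i)).le.trans h2)
  have hprod : ∀ i j, |u.eval (x j) * u.eval (x i)| ≤ D * S := fun i j => by
    rw [abs_mul]
    nlinarith [hsq i, hsq j, sq_abs (u.eval (x i)), sq_abs (u.eval (x j)),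
      sq_nonneg (|u.eval (x i)| - |u.eval (x j)|)]
  have hL : ∀ j, L j u = ∑ i, u.eval (x i) * L j (ℓ i) := fun j => by
    conv_lhs => rw [hrepr]
    simp
  rw [Finset.sum_mul]
  refine (Finset.abs_sum_le_sum_abs _ _).trans (Finset.sum_le_sum fun j _ => ?_)
  rw [hL, Finset.mul_sum, Finset.mul_sum, Finset.sum_mul]
  refine (Finset.abs_sum_le_sum_abs _ _).trans (Finset.sum_le_sum fun i _ => ?_)
  rw [show w j * (u.eval (x j) * (u.eval (x i) * L j (ℓ i))) =
    w j * L j (ℓ i) * (u.eval (x j) * u.eval (x i)) by ring, abs_mul, abs_mul,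
    abs_of_pos (hw j), mul_assoc _ D S]
  exact mul_le_mul_of_nonneg_left (hprod i j) (mul_nonneg (hw j).le (abs_nonneg _))

/-- Discrete Grönwall inequality for θ-weighted increments. -/
lemma discrete_gronwall_theta {A F : ℕ → ℝ} (hA : ∀ k, 0 ≤ A k) (hF : ∀ k, 0 ≤ F k)
    {L θ τ : ℝ} (hL : 0 < L) (hθ₀ : 0 ≤ θ) (hθ₁ : θ ≤ 1) (hτ : 0 < τ) (hτL : τ ≤ 1 / (2 * L))
    (hstep : ∀ k, A (k + 1) - A k ≤
      τ * L * (θ * A (k + 1) + (1 - θ) * A k) + τ * (θ * F (k + 1) + (1 - θ) * F k)) (M : ℕ) :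
    A M ≤ Real.exp (2 * L * (M * τ)) * (A 0 + τ * ∑ k ∈ Finset.range (M + 1), F k) := by
  have hτL' : τ * L ≤ 1 / 2 := by
    rw [le_div_iff₀ (by positivity)] at hτL
    linarith
  have hτL0 : 0 < τ * L := mul_pos hτ hL
  have hd : 1 / 2 ≤ 1 - τ * L * θ := by nlinarith
  set r := Real.exp (2 * L * τ) with hr
  have hr1 : 1 + 2 * (τ * L) ≤ r := by
    have := Real.add_one_le_exp (2 * L * τ)
    linarith
  have hone : ∀ k, A (k + 1) ≤ r * (A k + τ * (θ * F (k + 1) + (1 - θ) * F k)) := fun k => by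
    have hG : 0 ≤ τ * (θ * F (k + 1) + (1 - θ) * F k) :=
      mul_nonneg hτ.le (add_nonneg (mul_nonneg hθ₀ (hF _)) (mul_nonneg (by linarith) (hF _)))
    set G := τ * (θ * F (k + 1) + (1 - θ) * F k)
    have h1 : (1 - τ * L * θ) * A (k + 1) ≤ (1 + τ * L * (1 - θ)) * (A k + G) := by
      have : 0 ≤ τ * L * (1 - θ) * G := mul_nonneg (mul_nonneg hτL0.le (by linarith)) hG
      linarith [hstep k]
    have h2 : 1 + τ * L * (1 - θ) ≤ (1 - τ * L * θ) * (1 + 2 * (τ * L)) := by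
      nlinarith
    have h3 : (1 - τ * L * θ) * A (k + 1) ≤ (1 - τ * L * θ) * (r * (A k + G)) := by
      refine h1.trans ?_
      rw [← mul_assoc]
      refine mul_le_mul_of_nonneg_right (h2.trans ?_) (add_nonneg (hA k) hG)
      exact mul_le_mul_of_nonneg_left hr1 (by linarith)
    exact le_of_mul_le_mul_left h3 (by linarith)
  have hind : ∀ k, A k ≤ r ^ k * (A 0 + τ * (∑ i ∈ Finset.range k, F i + θ * F k)) := fun k => by
    induction k with
    | zero =>
      have := mul_nonneg hτ.le (mul_nonneg hθ₀ (hF 0))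
      simpa using this
    | succ k ih =>
      have hrk : 1 ≤ r ^ k := one_le_pow₀ (by linarith)
      have hr0 : 0 ≤ r := by linarith
      have hG : 0 ≤ τ * (θ * F (k + 1) + (1 - θ) * F k) :=
        mul_nonneg hτ.le (add_nonneg (mul_nonneg hθ₀ (hF _)) (mul_nonneg (by linarith) (hF _)))
      refine (hone k).trans ?_
      rw [pow_succ', mul_assoc]
      refine mul_le_mul_of_nonneg_left ?_ hr0
      rw [Finset.sum_range_succ]
      have h1 := mul_le_mul_of_nonneg_right hrk hG
      linarith
  have hexp : r ^ M = Real.exp (2 * L * (M * τ)) := by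
    rw [hr, ← Real.exp_nat_mul]
    ring_nf
  rw [← hexp]
  refine (hind M).trans (mul_le_mul_of_nonneg_left ?_ (pow_nonneg (by linarith) _))
  rw [Finset.sum_range_succ]
  have := mul_le_of_le_one_left (hF M) hθ₁
  gcongr

/-- One θ-step of the energy estimate, for an evolution whose spatial operator `R` is bounded
above by `K` along the θ-average. -/
lemma theta_step_energy_le {ι : Type*} [Fintype ι] {w a b f g R : ι → ℝ} (hw : ∀ i, 0 ≤ w i)
    {θ τ K : ℝ} (hθ₁ : 1 / 2 ≤ θ) (hθ₂ : θ ≤ 1) (hτ : 0 < τ) (hK : 0 ≤ K)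
    (hR : ∑ j, w j * ((θ * b j + (1 - θ) * a j) * R j) ≤
      K * ∑ j, (θ * b j + (1 - θ) * a j) ^ 2 * w j)
    (hstep : ∀ j, (θ * b j + (1 - θ) * a j) * ((b j - a j) / τ) =
      (θ * b j + (1 - θ) * a j) * (R j + (θ * g j + (1 - θ) * f j))) :
    ∑ j, b j ^ 2 * w j - ∑ j, a j ^ 2 * w j ≤
      τ * (2 * K + 1) * (θ * ∑ j, b j ^ 2 * w j + (1 - θ) * ∑ j, a j ^ 2 * w j) +
        τ * (θ * ∑ j, g j ^ 2 * w j + (1 - θ) * ∑ j, f j ^ 2 * w j) := by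
  have hconv : ∀ s t : ℝ, (θ * s + (1 - θ) * t) ^ 2 ≤ θ * s ^ 2 + (1 - θ) * t ^ 2 := fun s t => by
    nlinarith [mul_nonneg (mul_nonneg (show 0 ≤ θ by linarith) (sub_nonneg.2 hθ₂))
      (sq_nonneg (s - t))]
  have hpt : ∀ j, b j ^ 2 * w j - a j ^ 2 * w j ≤
      2 * τ * (w j * ((θ * b j + (1 - θ) * a j) * R j)) +
        τ * ((θ * b j + (1 - θ) * a j) ^ 2 * w j) +
        τ * (θ * (g j ^ 2 * w j) + (1 - θ) * (f j ^ 2 * w j)) := fun j => by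
    have h1 : (θ * b j + (1 - θ) * a j) * (b j - a j) =
        τ * ((θ * b j + (1 - θ) * a j) * (R j + (θ * g j + (1 - θ) * f j))) := by
      rw [← hstep j]
      field_simp
    have h2 : b j ^ 2 - a j ^ 2 ≤ 2 * ((θ * b j + (1 - θ) * a j) * (b j - a j)) := by
      nlinarith [mul_nonneg (show 0 ≤ 2 * θ - 1 by linarith) (sq_nonneg (b j - a j))]
    have h3 : 2 * ((θ * b j + (1 - θ) * a j) * (θ * g j + (1 - θ) * f j)) ≤
        (θ * b j + (1 - θ) * a j) ^ 2 + (θ * g j ^ 2 + (1 - θ) * f j ^ 2) := by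
      nlinarith [hconv (g j) (f j),
        sq_nonneg (θ * b j + (1 - θ) * a j - (θ * g j + (1 - θ) * f j))]
    have h4 : b j ^ 2 - a j ^ 2 ≤ 2 * τ * ((θ * b j + (1 - θ) * a j) * R j) +
        τ * (θ * b j + (1 - θ) * a j) ^ 2 + τ * (θ * g j ^ 2 + (1 - θ) * f j ^ 2) := by
      have := mul_le_mul_of_nonneg_left h3 hτ.le
      rw [h1] at h2
      linarith
    linarith [mul_le_mul_of_nonneg_right h4 (hw j)]
  have hsum := Finset.sum_le_sum fun j (_ : j ∈ Finset.univ) => hpt j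
  simp only [Finset.sum_sub_distrib, Finset.sum_add_distrib, ← Finset.mul_sum] at hsum
  have hE : ∑ j, (θ * b j + (1 - θ) * a j) ^ 2 * w j ≤
      θ * ∑ j, b j ^ 2 * w j + (1 - θ) * ∑ j, a j ^ 2 * w j := by
    rw [Finset.mul_sum, Finset.mul_sum, ← Finset.sum_add_distrib]
    refine Finset.sum_le_sum fun j _ => ?_
    linarith [mul_le_mul_of_nonneg_right (hconv (b j) (a j)) (hw j)]
  have h5 := mul_le_mul_of_nonneg_left hR (show 0 ≤ 2 * τ by linarith)
  have h6 := mul_le_mul_of_nonneg_left hE (show 0 ≤ τ * (2 * K + 1) by positivity)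
  linarith

/-- On the Legendre–Gauss–Lobatto nodes the weights are positive and differentiation is
skew-symmetric for polynomials vanishing at the endpoints. -/
lemma gaussLobatto_weights {N : ℕ} (hN : 2 ≤ N) {x : Fin (N + 1) → ℝ} (hx : StrictMono x)
    (hroot : ∀ i, (1 - x i ^ 2) * deriv (legendreP N) (x i) = 0) {w : Fin (N + 1) → ℝ}
    (hw : ∀ i, w i = 2 / ((N : ℝ) * (N + 1) * legendreP N (x i) ^ 2)) :
    (∀ i, 0 < w i) ∧ ∀ u : ℝ[X], u.natDegree ≤ N → u.eval (-1) = 0 → u.eval 1 = 0 →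
      ∑ j, w j * (u.eval (x j) * u.derivative.eval (x j)) = 0 := by
  have hroot' : ∀ i, ((1 - X ^ 2) * derivative (legendrePoly N)).eval (x i) = 0 := fun i => by
    have := hroot i
    rw [legendreP_eq_eval, Polynomial.deriv] at this
    simpa using this
  have hodd := derivative_one_sub_sq_mul_derivative_legendrePoly N
  set W : ℝ[X] := (1 - X ^ 2) * derivative (legendrePoly N) with hWdef
  have hX : (1 - X ^ 2 : ℝ[X]) ≠ 0 := fun h => by
    have := congrArg (fun v : ℝ[X] => v.eval 0) h
    simp at this
  have hW : W ≠ 0 := mul_ne_zero hX (derivative_legendrePoly_ne_zero (by omega))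
  have hdeg : W.natDegree ≤ Fintype.card (Fin (N + 1)) := by
    have h1 : (1 - X ^ 2 : ℝ[X]).natDegree ≤ 2 := by compute_degree
    have h2 := natDegree_derivative_le (legendrePoly N)
    have h3 := natDegree_legendrePoly_le N
    have h4 := natDegree_mul_le (p := (1 - X ^ 2 : ℝ[X])) (q := derivative (legendrePoly N))
    rw [Fintype.card_fin, hWdef]
    omega
  have hN0 : (0 : ℝ) < N := by exact_mod_cast by omega
  have hW' := eval_derivative_ne_zero_of_roots hx.injective hW hdeg hroot'
  have hev : ∀ y, W.derivative.eval y = -((N : ℝ) * (N + 1)) * legendreP N y := fun y => by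
    rw [hodd, legendreP_eq_eval]
    simp
  have hP : ∀ i, legendreP N (x i) ≠ 0 := fun i h => hW' i (by rw [hev, h, mul_zero])
  refine ⟨fun i => ?_, fun u hu hu₁ hu₂ => ?_⟩
  · rw [hw]
    have := hP i
    positivity
  have hu0 : ∀ i, W.derivative.derivative.eval (x i) = 0 ∨ u.eval (x i) = 0 := fun i => by
    have h := hroot' i
    rw [hWdef, eval_mul, mul_eq_zero] at h
    rcases h with h | h
    · right
      have h1 : (x i - 1) * (x i + 1) = 0 := by
        simp at h
        linarith
      rcases mul_eq_zero.1 h1 with h2 | h2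
      · rwa [sub_eq_zero.1 h2]
      · rwa [eq_neg_of_add_eq_zero_left h2]
    · left
      rw [hodd, ← C_neg, derivative_C_mul, eval_mul, h, mul_zero]
  have hudeg : u.degree < Fintype.card (Fin (N + 1)) := by
    refine degree_le_natDegree.trans_lt ?_
    rw [Fintype.card_fin]
    exact_mod_cast Nat.lt_succ_of_le hu
  have h := sum_eval_mul_eval_derivative_div_eq_zero hx.injective hW hdeg hroot' hudeg hu0
  have hterm : ∀ j, w j * (u.eval (x j) * u.derivative.eval (x j)) =
      2 * (N * (N + 1)) *
        (u.eval (x j) * u.derivative.eval (x j) / W.derivative.eval (x j) ^ 2) := fun j => by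
    have := hP j
    rw [hw, hev]
    field_simp
  simp only [hterm]
  rw [← Finset.mul_sum, h, mul_zero]

end Stability

/-- **Stability of the full-discrete θ-scheme** (Theorem 2 of the paper).
On the Legendre–Gauss–Lobatto nodes `-1 = x_0 < … < x_N = 1` with weights
`w_i = 2/(N(N+1)P_N(x_i)²)`, for `1/2 ≤ θ ≤ 1` there exist constants
`C = C(N,α,κ_α,p,q,θ) > 0` and `τ₀ > 0` such that, for any time step
`τ ∈ (0,τ₀]`, any sequence `(U^k)` of polynomials of degree ≤ N vanishing at
`±1`, and any nodal data `(f^k)` satisfying at the interior nodes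
`(U^{k+1}(x_j) − U^k(x_j))/τ = κ_α ∇^α U_θ^{k+1}(x_j) − ν_α (U_θ^{k+1})'(x_j) + f_θ^{k+1}(x_j)`,
one has for every `M ≥ 1`, with `T = Mτ`:
`‖U^M‖_N² ≤ exp(CT)(‖U^0‖_N² + τ Σ_{k=0}^M ‖f^k‖_N²)`. -/
theorem full_discrete_theta_scheme_stability (N : ℕ) (hN : 2 ≤ N)
    (α : ℝ) (hα₁ : 1 < α) (hα₂ : α < 2) (κ : ℝ) (hκ : 0 < κ)
    (p q : ℝ) (hp : 0 ≤ p) (hq : 0 ≤ q) (hpq : p + q = 1)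
    (θ : ℝ) (hθ₁ : 1 / 2 ≤ θ) (hθ₂ : θ ≤ 1)
    (x : Fin (N + 1) → ℝ) (hx : StrictMono x)
    (hx0 : x 0 = -1) (hxN : x (Fin.last N) = 1)
    (hroot : ∀ i, (1 - x i ^ 2) * deriv (legendreP N) (x i) = 0)
    (w : Fin (N + 1) → ℝ)
    (hw : ∀ i, w i = 2 / ((N : ℝ) * (N + 1) * legendreP N (x i) ^ 2)) :
    ∃ C > 0, ∃ τ₀ > 0, ∀ ν : ℝ, 0 < ν →
      ∀ τ : ℝ, 0 < τ → τ ≤ τ₀ →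
      ∀ (U : ℕ → Polynomial ℝ) (f : ℕ → Fin (N + 1) → ℝ),
      (∀ k, (U k).natDegree ≤ N) →
      (∀ k, (U k).eval (-1) = 0) → (∀ k, (U k).eval 1 = 0) →
      (∀ k : ℕ, ∀ j : Fin (N + 1), j ≠ 0 → j ≠ Fin.last N →
        ((U (k + 1)).eval (x j) - (U k).eval (x j)) / τ =
          κ * fracGrad α p q
              (fun s => θ * (U (k + 1)).eval s + (1 - θ) * (U k).eval s) (x j)
            - ν * (θ * (U (k + 1)).derivative.eval (x j) +
                (1 - θ) * (U k).derivative.eval (x j))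
            + (θ * f (k + 1) j + (1 - θ) * f k j)) →
      ∀ M : ℕ, 1 ≤ M →
        ∑ j : Fin (N + 1), ((U M).eval (x j)) ^ 2 * w j ≤
          Real.exp (C * (M * τ)) *
            (∑ j : Fin (N + 1), ((U 0).eval (x j)) ^ 2 * w j +
              τ * ∑ k ∈ Finset.range (M + 1),
                ∑ j : Fin (N + 1), (f k j) ^ 2 * w j) := by
  obtain ⟨hwpos, hskew⟩ := gaussLobatto_weights hN hx hroot hw
  have hint : ∀ j : Fin (N + 1), j ≠ 0 → j ≠ Fin.last N → x j ∈ Set.Ioo (-1 : ℝ) 1 :=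
    fun j h0 hl => ⟨hx0 ▸ hx (Fin.pos_iff_ne_zero.2 h0), hxN ▸ hx (Fin.lt_last_iff_ne_last.2 hl)⟩
  classical
  let G : Fin (N + 1) → ℝ[X] →ₗ[ℝ] ℝ := fun j =>
    if h : x j ∈ Set.Ioo (-1 : ℝ) 1 then fracGradLinear hα₂ p q h else 0
  obtain ⟨K, hK0, hK⟩ := exists_abs_sum_mul_le hx.injective hwpos G
  have hL : 0 < 2 * (κ * K) + 1 := by positivity
  refine ⟨2 * (2 * (κ * K) + 1), by positivity, 1 / (2 * (2 * (κ * K) + 1)), by positivity, ?_⟩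
  intro ν _ τ hτ hτ₀ U f hdeg hU₁ hU₂ hscheme M _
  refine discrete_gronwall_theta (A := fun k => ∑ j, (U k).eval (x j) ^ 2 * w j)
    (F := fun k => ∑ j, f k j ^ 2 * w j)
    (fun k => Finset.sum_nonneg fun j _ => mul_nonneg (sq_nonneg _) (hwpos j).le)
    (fun k => Finset.sum_nonneg fun j _ => mul_nonneg (sq_nonneg _) (hwpos j).le)
    hL (by linarith) hθ₂ hτ hτ₀ (fun k => ?_) M
  set E : ℝ[X] := C θ * U (k + 1) + C (1 - θ) * U k with hE
  have hEev : ∀ s, E.eval s = θ * (U (k + 1)).eval s + (1 - θ) * (U k).eval s := fun s => by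
    simp [hE]
  have hEder : ∀ s, E.derivative.eval s =
      θ * (U (k + 1)).derivative.eval s + (1 - θ) * (U k).derivative.eval s := fun s => by
    simp [hE]
  have hEdeg : E.natDegree ≤ N :=
    natDegree_add_le_of_degree_le ((natDegree_C_mul_le _ _).trans (hdeg _))
      ((natDegree_C_mul_le _ _).trans (hdeg _))
  have hEdeg' : E.degree < Fintype.card (Fin (N + 1)) := by
    refine degree_le_natDegree.trans_lt ?_
    rw [Fintype.card_fin]
    exact_mod_cast Nat.lt_succ_of_le hEdeg
  refine theta_step_energy_le (R := fun j => κ * G j E - ν * E.derivative.eval (x j))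
    (fun j => (hwpos j).le) hθ₁ hθ₂ hτ (by positivity) ?_ fun j => ?_
  · simp only [← hEev]
    have h1 := hskew E hEdeg (by simp [hEev, hU₁]) (by simp [hEev, hU₂])
    have h2 := (le_abs_self _).trans (hK E hEdeg')
    have h3 : ∑ j, w j * (E.eval (x j) * (κ * G j E - ν * E.derivative.eval (x j))) =
        κ * ∑ j, w j * (E.eval (x j) * G j E) -
          ν * ∑ j, w j * (E.eval (x j) * E.derivative.eval (x j)) := by
      rw [Finset.mul_sum, Finset.mul_sum, ← Finset.sum_sub_distrib]
      exact Finset.sum_congr rfl fun j _ => by ring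
    rw [h3, h1, mul_zero, sub_zero, mul_assoc]
    exact mul_le_mul_of_nonneg_left h2 hκ.le
  · rcases eq_or_ne j 0 with rfl | h0
    · simp [hx0, hU₁]
    rcases eq_or_ne j (Fin.last N) with rfl | hl
    · simp [hxN, hU₂]
    have hG : G j E = fracGrad α p q
        (fun s => θ * (U (k + 1)).eval s + (1 - θ) * (U k).eval s) (x j) := by
      simp only [G, dif_pos (hint j h0 hl), ← hEev]
      rfl
    rw [hscheme k j h0 hl, hG, hEder]
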